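/- Let ℱ ⊆ 𝒜 and define a relation ∥ on the set of lines by: M ∥ N iff there exists L ∈ 𝒜 such that either (L ∈ ℱ and M ∥ℓ L and N ∥ℓ L) or (L ∈ 𝒜 \ ℱ and M ∥r L and N ∥r L). Then ∥ is an equivalence relation (and in that case a parallelism) if and only if ℱ is invariant under all inner automorphisms of H, i.e., for every h ∈ H with h ≠ 0 and every L ∈ ℱ, the line h⁻¹·L·h = {h⁻¹·z·h | z ∈ L} belongs to ℱ. -/

import Mathlib

variable (F H : Type*) [Field F] [DivisionRing H] [Algebra F H]

/-- A *line* of the projective space `ℙ(H_F)`: a 2-dimensional `F`-subspace of `H`. -/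
abbrev Line := {M : Submodule F H // Module.finrank F M = 2}

/-- `M ∥ℓ N` : there is `g ≠ 0` with `N = g·M`. -/
def LeftPar (M N : Submodule F H) : Prop :=
  ∃ g : H, g ≠ 0 ∧ (N : Set H) = (fun m => g * m) '' (M : Set H)

/-- `M ∥r N` : there is `g ≠ 0` with `N = M·g`. -/
def RightPar (M N : Submodule F H) : Prop :=
  ∃ g : H, g ≠ 0 ∧ (N : Set H) = (fun m => m * g) '' (M : Set H)

/-- The left parallel class `Sℓ(M) = {N | N ∥ℓ M}`. -/
def leftClass (M : Line F H) : Set (Line F H) := {N | LeftPar F H N.1 M.1}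

/-- The right parallel class `Sr(M) = {N | N ∥r M}`. -/
def rightClass (M : Line F H) : Set (Line F H) := {N | RightPar F H N.1 M.1}

/-- The `∥`-class `S(M) = {N | N ∥ M}`. -/
def parClass (par : Line F H → Line F H → Prop) (M : Line F H) : Set (Line F H) :=
  {N | par N M}

/-- A parallelism: an equivalence relation on lines such that for every `x ≠ 0`
and every line `M` there is exactly one line `N` with `x ∈ N` and `N ∥ M`. -/
def IsParallelism (par : Line F H → Line F H → Prop) : Prop :=
  Equivalence par ∧
    ∀ x : H, x ≠ 0 → ∀ M : Line F H, ∃! N : Line F H, x ∈ N.1 ∧ par N M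

/-- A Clifford-like parallelism: every `∥`-class is a left or a right parallel class. -/
def IsCliffordLike (par : Line F H → Line F H → Prop) : Prop :=
  IsParallelism F H par ∧
    ∀ M : Line F H,
      parClass F H par M = leftClass F H M ∨ parClass F H par M = rightClass F H M

/-- The star `𝒜` of lines through `F·1`, i.e. the lines containing `1`. -/
def starLines : Set (Line F H) := {L | (1 : H) ∈ L.1}

/-- The set `ℱ` of lines of `𝒜` whose `∥`-class is a left parallel class. -/
def calF (par : Line F H → Line F H → Prop) : Set (Line F H) :=
  {L | (1 : H) ∈ L.1 ∧ parClass F H par L = leftClass F H L}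

/-- A semilinear bijection of `H` (over some field automorphism of `F`). -/
def IsSemilinear (β : H → H) : Prop :=
  Function.Bijective β ∧ (∀ x y : H, β (x + y) = β x + β y) ∧
    ∃ σ : F ≃+* F, ∀ (a : F) (x : H), β (a • x) = σ a • β x

/-- `β` preserves the parallelism `par`: for all lines `M, N`,
`M ∥ N ↔ β(M) ∥ β(N)`, where `β(M)` denotes the line whose carrier is `β '' M`. -/
def Preserves (β : H → H) (par : Line F H → Line F H → Prop) : Prop :=
  ∀ M N M' N' : Line F H,
    (M'.1 : Set H) = β '' (M.1 : Set H) →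
    (N'.1 : Set H) = β '' (N.1 : Set H) →
    (par M N ↔ par M' N')

/-- The image `β(𝒢)` of a set of lines under `β`. -/
def imageLines (β : H → H) (G : Set (Line F H)) : Set (Line F H) :=
  {L' | ∃ L ∈ G, (L'.1 : Set H) = β '' (L.1 : Set H)}

/-- The centre of `H` is exactly `F·1`. -/
def CenterEqF : Prop :=
  ∀ z : H, (∀ x : H, z * x = x * z) ↔ ∃ a : F, z = algebraMap F H a

/-- Ring automorphism of `H`, as a plain function. -/
def IsRingAutFn (α : H → H) : Prop :=
  Function.Bijective α ∧ (∀ x y : H, α (x + y) = α x + α y) ∧ α 1 = 1 ∧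
    ∀ x y : H, α (x * y) = α x * α y

/-- Ring antiautomorphism of `H`, as a plain function. -/
def IsRingAntiAutFn (α : H → H) : Prop :=
  Function.Bijective α ∧ (∀ x y : H, α (x + y) = α x + α y) ∧ α 1 = 1 ∧
    ∀ x y : H, α (x * y) = α y * α x

/-- The relation obtained by blending left classes (for lines of `ℱ`) and right
classes (for lines of `𝒜 \ ℱ`). -/
def blendPar (ℱ : Set (Line F H)) (M N : Line F H) : Prop :=
  ∃ L : Line F H, (1 : H) ∈ L.1 ∧
    ((L ∈ ℱ ∧ LeftPar F H M.1 L.1 ∧ LeftPar F H N.1 L.1) ∨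
     (L ∉ ℱ ∧ RightPar F H M.1 L.1 ∧ RightPar F H N.1 L.1))

section

variable {F H}

/-- A finite-dimensional subalgebra of a division ring is closed under inversion. -/
theorem Subalgebra.inv_mem_of_finiteDimensional (S : Subalgebra F H) [FiniteDimensional F S]
    {x : H} (hx : x ∈ S) : x⁻¹ ∈ S := by
  rcases eq_or_ne x 0 with rfl | h0
  · simp
  obtain ⟨y, hy⟩ := FiniteDimensional.exists_mul_eq_one F (x := (⟨x, hx⟩ : S))
    fun h => h0 (congrArg Subtype.val h)
  have hxy : x * y = 1 := congrArg Subtype.val hy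
  rw [inv_eq_of_mul_eq_one_right hxy]
  exact y.2

/-- In a quaternion skew field every line through `1` is a subalgebra. -/
theorem exists_subalgebra_eq_of_one_mem (hcenter : CenterEqF F H)
    (hdim : Module.finrank F H = 4) {L : Submodule F H} (hL : Module.finrank F L = 2)
    (h1 : (1 : H) ∈ L) : ∃ S : Subalgebra F H, Subalgebra.toSubmodule S = L := by
  have : FiniteDimensional F H := Module.finite_of_finrank_pos (by omega)
  obtain ⟨a, haL, ha⟩ : ∃ a ∈ L, a ∉ Submodule.span F {(1 : H)} := by
    by_contra! h
    have := (Submodule.finrank_mono h).trans_eq (finrank_span_singleton (one_ne_zero' H))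
    omega
  have ha' : ¬ ∃ c : F, a = algebraMap F H c := by
    rintro ⟨c, rfl⟩
    exact ha (Submodule.mem_span_singleton.2 ⟨c, (Algebra.algebraMap_eq_smul_one c).symm⟩)
  let S := Algebra.adjoin F {a}
  have hspan : Module.finrank F (Submodule.span F {1, a}) = 2 := by
    have hli : LinearIndependent F ![1, a] :=
      (LinearIndependent.pair_iff' one_ne_zero).2
        fun c hc => ha (Submodule.mem_span_singleton.2 ⟨c, hc⟩)
    rw [← Matrix.range_cons_cons_empty 1 a ![], finrank_span_eq_card hli, Fintype.card_fin]
  have hLeq : Submodule.span F {1, a} = L :=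
    Submodule.eq_of_le_of_finrank_eq
      (Submodule.span_le.2 (by rintro x (rfl | rfl) <;> assumption)) (hspan.trans hL.symm)
  have hle : L ≤ Subalgebra.toSubmodule S := by
    rw [← hLeq, Submodule.span_le]
    rintro x (rfl | rfl)
    · exact one_mem S
    · exact Algebra.self_mem_adjoin_singleton F x
  refine ⟨S, (Submodule.eq_of_le_of_finrank_eq hle ?_).symm⟩
  have hge := Submodule.finrank_mono hle
  rw [hL, Subalgebra.finrank_toSubmodule] at hge ⊢
  have hdvd : Module.finrank F S ∣ 2 ^ 2 := by
    let := divisionRingOfFiniteDimensional F S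
    exact ⟨_, (hdim.symm.trans (Module.finrank_mul_finrank F S H).symm)⟩
  obtain ⟨k, hk, hSk⟩ := (Nat.dvd_prime_pow Nat.prime_two).1 hdvd
  have hk2 : k ≠ 2 := by
    rintro rfl
    have htop : Subalgebra.toSubmodule S = ⊤ :=
      Submodule.eq_top_of_finrank_eq (by rw [Subalgebra.finrank_toSubmodule, hSk, hdim]; rfl)
    refine ha' ((hcenter a).1 fun x => ?_)
    have hx : x ∈ S := (Algebra.toSubmodule_eq_top.1 htop) ▸ Algebra.mem_top
    exact Algebra.commute_of_mem_adjoin_self hx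
  interval_cases k <;> simp_all

theorem mul_mem_of_one_mem (hcenter : CenterEqF F H) (hdim : Module.finrank F H = 4)
    {L : Line F H} (h1 : (1 : H) ∈ L.1) {x y : H} (hx : x ∈ L.1) (hy : y ∈ L.1) :
    x * y ∈ L.1 := by
  obtain ⟨S, hS⟩ := exists_subalgebra_eq_of_one_mem hcenter hdim L.2 h1
  rw [← hS] at hx hy ⊢
  exact S.mul_mem hx hy

theorem inv_mem_of_one_mem (hcenter : CenterEqF F H) (hdim : Module.finrank F H = 4)
    {L : Line F H} (h1 : (1 : H) ∈ L.1) {x : H} (hx : x ∈ L.1) : x⁻¹ ∈ L.1 := by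
  have : FiniteDimensional F H := Module.finite_of_finrank_pos (by omega)
  obtain ⟨S, hS⟩ := exists_subalgebra_eq_of_one_mem hcenter hdim L.2 h1
  rw [← hS] at hx ⊢
  exact S.inv_mem_of_finiteDimensional hx

theorem Line.exists_mem_ne_zero (N : Line F H) : ∃ x ∈ N.1, x ≠ 0 := by
  refine Submodule.exists_mem_ne_zero_of_ne_bot fun h => ?_
  have hN := N.2
  rw [h, finrank_bot] at hN
  omega

/-- The line `{y | x⁻¹ * y ∈ M}`, that is `x * M`. -/
theorem Line.exists_mem_iff_inv_mul_mem (M : Line F H) {x : H} (hx : x ≠ 0) :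
    ∃ N : Line F H, ∀ y, y ∈ N.1 ↔ x⁻¹ * y ∈ M.1 := by
  refine ⟨⟨M.1.map (LinearMap.mulLeft F x), ?_⟩, fun y => ?_⟩
  · exact (Submodule.equivMapOfInjective _
      (mul_right_injective₀ hx) M.1).finrank_eq.symm.trans M.2
  · refine ⟨?_, fun h => ⟨_, h, by simp [hx]⟩⟩
    rintro ⟨z, hz, rfl⟩
    simpa [hx] using hz

/-- The line `{y | y * x⁻¹ ∈ M}`, that is `M * x`. -/
theorem Line.exists_mem_iff_mul_inv_mem (M : Line F H) {x : H} (hx : x ≠ 0) :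
    ∃ N : Line F H, ∀ y, y ∈ N.1 ↔ y * x⁻¹ ∈ M.1 := by
  refine ⟨⟨M.1.map (LinearMap.mulRight F x), ?_⟩, fun y => ?_⟩
  · exact (Submodule.equivMapOfInjective _
      (mul_left_injective₀ hx) M.1).finrank_eq.symm.trans M.2
  · refine ⟨?_, fun h => ⟨_, h, by simp [hx]⟩⟩
    rintro ⟨z, hz, rfl⟩
    simpa [hx] using hz

theorem leftPar_of_mem_iff {N L : Submodule F H} {x : H} (hx : x ≠ 0)
    (h : ∀ y, y ∈ N ↔ x⁻¹ * y ∈ L) : LeftPar F H N L := by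
  refine ⟨x⁻¹, inv_ne_zero hx, Set.ext fun z => ⟨fun hz => ⟨x * z, ?_, ?_⟩, ?_⟩⟩
  · simpa [h, hx] using hz
  · simp [hx]
  · rintro ⟨y, hy, rfl⟩
    exact (h y).1 hy

theorem rightPar_of_mem_iff {N L : Submodule F H} {x : H} (hx : x ≠ 0)
    (h : ∀ y, y ∈ N ↔ y * x⁻¹ ∈ L) : RightPar F H N L := by
  refine ⟨x⁻¹, inv_ne_zero hx, Set.ext fun z => ⟨fun hz => ⟨z * x, ?_, ?_⟩, ?_⟩⟩
  · simpa [h, hx] using hz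
  · simp [hx]
  · rintro ⟨y, hy, rfl⟩
    exact (h y).1 hy

/-- A line `N` left parallel to a line `L` through `1` equals `x * L` for each nonzero
`x ∈ N`. -/
theorem LeftPar.mem_iff (hcenter : CenterEqF F H) (hdim : Module.finrank F H = 4)
    {N L : Line F H} (h1 : (1 : H) ∈ L.1) (hNL : LeftPar F H N.1 L.1) {x : H}
    (hxN : x ∈ N.1) (hx : x ≠ 0) (y : H) : y ∈ N.1 ↔ x⁻¹ * y ∈ L.1 := by
  obtain ⟨g, hg, hgN⟩ := hNL
  have hmem (z : H) : z ∈ N.1 ↔ g * z ∈ L.1 := by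
    rw [← SetLike.mem_coe (p := L.1), hgN, (mul_right_injective₀ hg).mem_set_image]
    rfl
  have hgx := (hmem x).1 hxN
  refine ⟨fun hy => ?_, fun hy => (hmem y).2 ?_⟩
  · simpa [mul_assoc, hg] using mul_mem_of_one_mem hcenter hdim h1
      (inv_mem_of_one_mem hcenter hdim h1 hgx) ((hmem y).1 hy)
  · simpa [mul_assoc, hx] using mul_mem_of_one_mem hcenter hdim h1 hgx hy

/-- A line `N` right parallel to a line `L` through `1` equals `L * x` for each nonzero
`x ∈ N`. -/
theorem RightPar.mem_iff (hcenter : CenterEqF F H) (hdim : Module.finrank F H = 4)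
    {N L : Line F H} (h1 : (1 : H) ∈ L.1) (hNL : RightPar F H N.1 L.1) {x : H}
    (hxN : x ∈ N.1) (hx : x ≠ 0) (y : H) : y ∈ N.1 ↔ y * x⁻¹ ∈ L.1 := by
  obtain ⟨g, hg, hgN⟩ := hNL
  have hmem (z : H) : z ∈ N.1 ↔ z * g ∈ L.1 := by
    rw [← SetLike.mem_coe (p := L.1), hgN, (mul_left_injective₀ hg).mem_set_image]
    rfl
  have hgx := (hmem x).1 hxN
  refine ⟨fun hy => ?_, fun hy => (hmem y).2 ?_⟩
  · simpa [mul_assoc, hg] using mul_mem_of_one_mem hcenter hdim h1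
      ((hmem y).1 hy) (inv_mem_of_one_mem hcenter hdim h1 hgx)
  · simpa [mul_assoc, hx] using mul_mem_of_one_mem hcenter hdim h1 hy hgx

/-- A line is left parallel to at most one line through `1`. -/
theorem LeftPar.eq_of_one_mem (hcenter : CenterEqF F H) (hdim : Module.finrank F H = 4)
    {N L L' : Line F H} (h1 : (1 : H) ∈ L.1) (h1' : (1 : H) ∈ L'.1)
    (h : LeftPar F H N.1 L.1) (h' : LeftPar F H N.1 L'.1) : L = L' := by
  obtain ⟨x, hxN, hx⟩ := N.exists_mem_ne_zero
  refine Subtype.ext (Submodule.ext fun z => ?_)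
  simpa [hx] using (h.mem_iff hcenter hdim h1 hxN hx (x * z)).symm.trans
    (h'.mem_iff hcenter hdim h1' hxN hx (x * z))

/-- A line is right parallel to at most one line through `1`. -/
theorem RightPar.eq_of_one_mem (hcenter : CenterEqF F H) (hdim : Module.finrank F H = 4)
    {N L L' : Line F H} (h1 : (1 : H) ∈ L.1) (h1' : (1 : H) ∈ L'.1)
    (h : RightPar F H N.1 L.1) (h' : RightPar F H N.1 L'.1) : L = L' := by
  obtain ⟨x, hxN, hx⟩ := N.exists_mem_ne_zero
  refine Subtype.ext (Submodule.ext fun z => ?_)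
  simpa [hx] using (h.mem_iff hcenter hdim h1 hxN hx (z * x)).symm.trans
    (h'.mem_iff hcenter hdim h1' hxN hx (z * x))

/-- Every line is left parallel to some line through `1`. -/
theorem Line.exists_leftPar_one_mem (N : Line F H) :
    ∃ L : Line F H, (1 : H) ∈ L.1 ∧ LeftPar F H N.1 L.1 := by
  obtain ⟨x, hxN, hx⟩ := N.exists_mem_ne_zero
  obtain ⟨L, hL⟩ := N.exists_mem_iff_inv_mul_mem (inv_ne_zero hx)
  exact ⟨L, by simpa [hL] using hxN, leftPar_of_mem_iff hx fun y => by simp [hL, hx]⟩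

/-- Every line is right parallel to some line through `1`. -/
theorem Line.exists_rightPar_one_mem (N : Line F H) :
    ∃ L : Line F H, (1 : H) ∈ L.1 ∧ RightPar F H N.1 L.1 := by
  obtain ⟨x, hxN, hx⟩ := N.exists_mem_ne_zero
  obtain ⟨L, hL⟩ := N.exists_mem_iff_mul_inv_mem (inv_ne_zero hx)
  exact ⟨L, by simpa [hL] using hxN, rightPar_of_mem_iff hx fun y => by simp [hL, hx]⟩

/-- A set of lines is invariant if it is stable under all inner automorphisms of `H`. -/
def InnerInvariant (ℱ : Set (Line F H)) : Prop :=
  ∀ h : H, h ≠ 0 → ∀ L ∈ ℱ, ∀ L' : Line F H,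
    (L'.1 : Set H) = (fun z => h⁻¹ * z * h) '' (L.1 : Set H) → L' ∈ ℱ

/-- The lines through `1` that are left and right parallel to a given line are conjugate. -/
theorem InnerInvariant.mem_iff (hcenter : CenterEqF F H) (hdim : Module.finrank F H = 4)
    {ℱ : Set (Line F H)} (hinv : InnerInvariant ℱ) {N L R : Line F H}
    (hL1 : (1 : H) ∈ L.1) (hR1 : (1 : H) ∈ R.1)
    (hL : LeftPar F H N.1 L.1) (hR : RightPar F H N.1 R.1) : L ∈ ℱ ↔ R ∈ ℱ := by
  obtain ⟨x, hxN, hx⟩ := N.exists_mem_ne_zero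
  have hmem (y : H) : x⁻¹ * y ∈ L.1 ↔ y * x⁻¹ ∈ R.1 :=
    (hL.mem_iff hcenter hdim hL1 hxN hx y).symm.trans (hR.mem_iff hcenter hdim hR1 hxN hx y)
  refine ⟨fun h => hinv x⁻¹ (inv_ne_zero hx) L h R (Set.ext fun z => ⟨fun hz => ?_, ?_⟩),
    fun h => hinv x hx R h L (Set.ext fun z => ⟨fun hz => ?_, ?_⟩)⟩
  · exact ⟨x⁻¹ * (z * x), (hmem _).2 (by simpa [hx] using hz), by simp [hx]⟩
  · rintro ⟨y, hy, rfl⟩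
    simpa using (hmem (x * y)).1 (by simpa [hx] using hy)
  · exact ⟨x * z * x⁻¹, (hmem _).1 (by simpa [hx] using hz), by simp [mul_assoc, hx]⟩
  · rintro ⟨y, hy, rfl⟩
    simpa [mul_assoc] using (hmem (y * x)).2 (by simpa [hx] using hy)

theorem InnerInvariant.blendPar_equivalence (hcenter : CenterEqF F H)
    (hdim : Module.finrank F H = 4) {ℱ : Set (Line F H)} (hinv : InnerInvariant ℱ) :
    Equivalence (blendPar F H ℱ) where
  refl M := by
    obtain ⟨L, hL1, hL⟩ := M.exists_leftPar_one_mem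
    obtain ⟨R, hR1, hR⟩ := M.exists_rightPar_one_mem
    by_cases h : L ∈ ℱ
    · exact ⟨L, hL1, .inl ⟨h, hL, hL⟩⟩
    · exact ⟨R, hR1, .inr ⟨mt (hinv.mem_iff hcenter hdim hL1 hR1 hL hR).2 h, hR, hR⟩⟩
  symm := by
    rintro M N ⟨L, h1, ⟨h, hM, hN⟩ | ⟨h, hM, hN⟩⟩
    · exact ⟨L, h1, .inl ⟨h, hN, hM⟩⟩
    · exact ⟨L, h1, .inr ⟨h, hN, hM⟩⟩
  trans := by
    rintro M N P ⟨L, h1, ⟨h, hM, hN⟩ | ⟨h, hM, hN⟩⟩ ⟨L', h1', ⟨h', hN', hP⟩ | ⟨h', hN', hP⟩⟩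
    · obtain rfl := hN.eq_of_one_mem hcenter hdim h1 h1' hN'
      exact ⟨L, h1, .inl ⟨h, hM, hP⟩⟩
    · exact absurd ((hinv.mem_iff hcenter hdim h1 h1' hN hN').1 h) h'
    · exact absurd ((hinv.mem_iff hcenter hdim h1' h1 hN' hN).1 h') h
    · obtain rfl := hN.eq_of_one_mem hcenter hdim h1 h1' hN'
      exact ⟨L, h1, .inr ⟨h, hM, hP⟩⟩

theorem innerInvariant_of_blendPar_refl (hcenter : CenterEqF F H)
    (hdim : Module.finrank F H = 4) {ℱ : Set (Line F H)} (hℱ : ∀ L ∈ ℱ, (1 : H) ∈ L.1)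
    (hrefl : ∀ N, blendPar F H ℱ N N) : InnerInvariant ℱ := by
  intro h hh L hL L' hL'
  have hmem (y : H) : h⁻¹ * y * h ∈ L'.1 ↔ y ∈ L.1 := by
    have hinj : Function.Injective fun z : H => h⁻¹ * z * h :=
      (mul_left_injective₀ hh).comp (mul_right_injective₀ (inv_ne_zero hh))
    rw [← SetLike.mem_coe, hL']
    exact hinj.mem_set_image
  have h1 := hℱ L hL
  have h1' : (1 : H) ∈ L'.1 := by simpa [hh] using (hmem 1).2 h1
  obtain ⟨N, hN⟩ := L.exists_mem_iff_mul_inv_mem hh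
  have hNR : RightPar F H N.1 L.1 := rightPar_of_mem_iff hh hN
  have hNL : LeftPar F H N.1 L'.1 := leftPar_of_mem_iff hh fun y => by
    rw [hN, ← hmem]
    simp [mul_assoc, hh]
  obtain ⟨K, hK1, ⟨hK, hNK, -⟩ | ⟨hK, hNK, -⟩⟩ := hrefl N
  · rwa [hNL.eq_of_one_mem hcenter hdim h1' hK1 hNK]
  · exact absurd (hNR.eq_of_one_mem hcenter hdim h1 hK1 hNK ▸ hL) hK

theorem isParallelism_blendPar (hcenter : CenterEqF F H) (hdim : Module.finrank F H = 4)
    {ℱ : Set (Line F H)} (heq : Equivalence (blendPar F H ℱ)) :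
    IsParallelism F H (blendPar F H ℱ) := by
  refine ⟨heq, fun x hx M => existsUnique_of_exists_of_unique ?_ ?_⟩
  · obtain ⟨L, h1, ⟨hL, hM, -⟩ | ⟨hL, hM, -⟩⟩ := heq.refl M
    · obtain ⟨N, hN⟩ := L.exists_mem_iff_inv_mul_mem hx
      exact ⟨N, by simpa [hN, hx] using h1, L, h1, .inl ⟨hL, leftPar_of_mem_iff hx hN, hM⟩⟩
    · obtain ⟨N, hN⟩ := L.exists_mem_iff_mul_inv_mem hx
      exact ⟨N, by simpa [hN, hx] using h1, L, h1, .inr ⟨hL, rightPar_of_mem_iff hx hN, hM⟩⟩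
  · rintro N N' ⟨hxN, hNM⟩ ⟨hxN', hNM'⟩
    refine Subtype.ext (Submodule.ext fun y => ?_)
    obtain ⟨L, h1, ⟨-, hN, hN'⟩ | ⟨-, hN, hN'⟩⟩ := heq.trans hNM (heq.symm hNM')
    · rw [hN.mem_iff hcenter hdim h1 hxN hx, hN'.mem_iff hcenter hdim h1 hxN' hx]
    · rw [hN.mem_iff hcenter hdim h1 hxN hx, hN'.mem_iff hcenter hdim h1 hxN' hx]

end

/-- The blended relation is an equivalence relation iff `ℱ` is invariant under all
inner automorphisms of `H`; and in that case it is a parallelism. -/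
theorem blendPar_equivalence_iff_inner_invariant
    (hcenter : CenterEqF F H) (hdim : Module.finrank F H = 4)
    (ℱ : Set (Line F H)) (hℱ : ∀ L ∈ ℱ, (1 : H) ∈ L.1) :
    (Equivalence (blendPar F H ℱ) ↔
      (∀ h : H, h ≠ 0 → ∀ L ∈ ℱ, ∀ L' : Line F H,
        (L'.1 : Set H) = (fun z => h⁻¹ * z * h) '' (L.1 : Set H) → L' ∈ ℱ)) ∧
    (Equivalence (blendPar F H ℱ) → IsParallelism F H (blendPar F H ℱ)) := by
  exact ⟨⟨fun heq => innerInvariant_of_blendPar_refl hcenter hdim hℱ heq.refl,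
      InnerInvariant.blendPar_equivalence hcenter hdim⟩,
    isParallelism_blendPar hcenter hdim⟩
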